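/- arXiv:1808.04777 — 3 statements merged into one kernel-verified Lean document; each statement's English description precedes it below -/
import Mathlib

section
/- Multiplier identity (Lemma 8.3, identity (8.1), radial form): let γ : (0,∞) → ℝ be smooth and κ ∈ ℝ. For every test function v, −Re ∫ ((ρ²+κ²) v + Δ_rad v) · conj(v) · γ dμ_d = ∫ γ ( |v′ + (ρ coth(r) − iκ) v|² + ρ(ρ−1) sinh(r)^{−2} |v|² ) dμ_d + 2κ Re ∫ i v · conj( γ (v′ + (ρ coth(r) − iκ) v) ) dμ_d − (1/2) ∫ γ″ |v|² dμ_d. -/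
open MeasureTheory Set

/-- A radial test function: a smooth function on `ℝ` with compact support
contained in `(0, ∞)`. -/
def IsTestFun (v : ℝ → ℂ) : Prop :=
  ContDiff ℝ (⊤ : ℕ∞) v ∧ HasCompactSupport v ∧ tsupport v ⊆ Set.Ioi (0 : ℝ)

/-- The hyperbolic cotangent. -/
noncomputable def cothR (r : ℝ) : ℝ := Real.cosh r / Real.sinh r

/-- `ρ = (d-1)/2`. -/
noncomputable def rho (d : ℕ) : ℝ := ((d : ℝ) - 1) / 2

/-- The radial part of the Laplace–Beltrami operator of hyperbolic space:
`Δ_rad f = f″ + (d−1) coth(r) f′`. -/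
noncomputable def DradC (d : ℕ) (v : ℝ → ℂ) (r : ℝ) : ℂ :=
  deriv (deriv v) r + ((((d : ℝ) - 1) * cothR r : ℝ) : ℂ) * deriv v r

/-- A function continuous on `(0, ∞)` and vanishing off a compact subset of `(0, ∞)` is
integrable. -/
theorem integrable_of_eq_zero_off_compact {E : Type*} [NormedAddCommGroup E] {f : ℝ → E}
    {K : Set ℝ} (hK : IsCompact K) (hK0 : K ⊆ Ioi (0 : ℝ)) (hf : ContinuousOn f (Ioi (0 : ℝ)))
    (hf0 : ∀ r, r ∉ K → f r = 0) : Integrable f := by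
  have hsub : tsupport f ⊆ K := by
    refine closure_minimal (fun r hr => ?_) hK.isClosed
    by_contra h
    exact hr (hf0 r h)
  exact (hf.continuous_of_tsupport_subset isOpen_Ioi
    (hsub.trans hK0)).integrable_of_hasCompactSupport (HasCompactSupport.intro hK hf0)

/-- The derivative of a function supported in a compact subset of `(0, ∞)` has integral zero. -/
theorem setIntegral_Ioi_eq_zero_of_hasDerivAt {F F' : ℝ → ℝ} {K : Set ℝ} (hK : IsCompact K)
    (hK0 : K ⊆ Ioi (0 : ℝ)) (hF : ∀ r, 0 < r → HasDerivAt F (F' r) r)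
    (hF' : ContinuousOn F' (Ioi (0 : ℝ))) (hF0 : ∀ r, r ∉ K → F r = 0)
    (hF'0 : ∀ r, r ∉ K → F' r = 0) : ∫ r in Ioi (0 : ℝ), F' r = 0 := by
  rw [setIntegral_eq_integral_of_forall_compl_eq_zero fun r hr => hF'0 r fun h => hr (hK0 h)]
  refine integral_eq_zero_of_hasDerivAt_of_integrable (f := F) (fun r => ?_)
    (integrable_of_eq_zero_off_compact hK hK0 hF' hF'0)
    (integrable_of_eq_zero_off_compact hK hK0
      (fun r hr => (hF r hr).continuousAt.continuousWithinAt) hF0)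
  by_cases hr : r ∈ K
  · exact hF r (hK0 hr)
  · rw [hF'0 r hr]
    refine (hasDerivAt_const r (0 : ℝ)).congr_of_eventuallyEq ?_
    filter_upwards [hK.isClosed.isOpen_compl.mem_nhds hr] with x hx using hF0 x hx

theorem hasDerivAt_cothR {r : ℝ} (hr : 0 < r) :
    HasDerivAt cothR (-(Real.sinh r ^ 2)⁻¹) r := by
  have hs : Real.sinh r ≠ 0 := (Real.sinh_pos_iff.2 hr).ne'
  refine HasDerivAt.congr_deriv (f := cothR)
    ((Real.hasDerivAt_cosh r).div (Real.hasDerivAt_sinh r) hs) ?_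
  field_simp
  linear_combination -Real.cosh_sq r

theorem continuousOn_cothR : ContinuousOn cothR (Ioi (0 : ℝ)) :=
  fun _ hr => (hasDerivAt_cothR hr).continuousAt.continuousWithinAt

/-- **Multiplier identity** (Lemma 8.3, identity (8.1), radial form). -/
theorem multiplier_identity (d : ℕ) (hd : 2 ≤ d)
    (γ : ℝ → ℝ) (hγ : ContDiffOn ℝ (⊤ : ℕ∞) γ (Ioi (0 : ℝ))) (κ : ℝ)
    (v : ℝ → ℂ) (hv : IsTestFun v) :
    - (∫ r in Ioi (0 : ℝ),
        (((rho d ^ 2 + κ ^ 2 : ℝ) : ℂ) * v r + DradC d v r) * (starRingEnd ℂ) (v r)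
          * ((γ r * Real.sinh r ^ (d - 1) : ℝ) : ℂ)).re
      = (∫ r in Ioi (0 : ℝ),
          γ r * (‖deriv v r + (((rho d * cothR r : ℝ) : ℂ) - Complex.I * (κ : ℂ)) * v r‖ ^ 2
              + rho d * (rho d - 1) * (Real.sinh r ^ 2)⁻¹ * ‖v r‖ ^ 2)
            * Real.sinh r ^ (d - 1))
        + 2 * κ * (∫ r in Ioi (0 : ℝ),
            Complex.I * v r
              * (starRingEnd ℂ) (((γ r : ℝ) : ℂ)
                  * (deriv v r + (((rho d * cothR r : ℝ) : ℂ) - Complex.I * (κ : ℂ)) * v r))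
              * ((Real.sinh r ^ (d - 1) : ℝ) : ℂ)).re
        - (1 / 2) * ∫ r in Ioi (0 : ℝ),
            deriv (deriv γ) r * ‖v r‖ ^ 2 * Real.sinh r ^ (d - 1) := by
  obtain ⟨hv, hc, hs⟩ := hv
  obtain ⟨n, rfl⟩ : ∃ n, d = n + 2 := ⟨d - 2, by omega⟩
  have hn : n + 2 - 1 = n + 1 := rfl
  rw [hn]
  have hv1 : ContDiff ℝ (⊤ : ℕ∞) (deriv v) := (contDiff_infty_iff_deriv.1 hv).2
  have hv2 : ContDiff ℝ (⊤ : ℕ∞) (deriv (deriv v)) := (contDiff_infty_iff_deriv.1 hv1).2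
  have hγ1 : ContDiffOn ℝ (⊤ : ℕ∞) (deriv γ) (Ioi (0 : ℝ)) :=
    ((contDiffOn_infty_iff_deriv_of_isOpen isOpen_Ioi).1 hγ).2
  have hγ2 : ContDiffOn ℝ (⊤ : ℕ∞) (deriv (deriv γ)) (Ioi (0 : ℝ)) :=
    ((contDiffOn_infty_iff_deriv_of_isOpen isOpen_Ioi).1 hγ1).2
  have cv : ContinuousOn v (Ioi (0 : ℝ)) := hv.continuous.continuousOn
  have cv1 : ContinuousOn (deriv v) (Ioi (0 : ℝ)) := hv1.continuous.continuousOn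
  have cv2 : ContinuousOn (deriv (deriv v)) (Ioi (0 : ℝ)) := hv2.continuous.continuousOn
  have cγ := hγ.continuousOn
  have cγ2 := hγ2.continuousOn
  have cc := continuousOn_cothR
  have csi : ContinuousOn (fun r : ℝ => (Real.sinh r ^ 2)⁻¹) (Ioi (0 : ℝ)) :=
    ContinuousOn.inv₀ (by fun_prop) fun r hr => pow_ne_zero 2 (Real.sinh_pos_iff.2 hr).ne'
  have v0 : ∀ r, r ∉ tsupport v → v r = 0 := fun r hr => image_eq_zero_of_notMem_tsupport hr
  have v10 : ∀ r, r ∉ tsupport v → deriv v r = 0 := fun r hr => by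
    by_contra h
    exact hr (support_deriv_subset h)
  set A : ℝ → ℂ := fun r =>
    (((rho (n + 2) ^ 2 + κ ^ 2 : ℝ) : ℂ) * v r + DradC (n + 2) v r) * (starRingEnd ℂ) (v r)
      * ((γ r * Real.sinh r ^ (n + 1) : ℝ) : ℂ) with hA
  set B : ℝ → ℝ := fun r =>
    γ r * (‖deriv v r + (((rho (n + 2) * cothR r : ℝ) : ℂ) - Complex.I * (κ : ℂ)) * v r‖ ^ 2
      + rho (n + 2) * (rho (n + 2) - 1) * (Real.sinh r ^ 2)⁻¹ * ‖v r‖ ^ 2)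
      * Real.sinh r ^ (n + 1) with hB
  set C : ℝ → ℂ := fun r =>
    Complex.I * v r
      * (starRingEnd ℂ) (((γ r : ℝ) : ℂ)
        * (deriv v r + (((rho (n + 2) * cothR r : ℝ) : ℂ) - Complex.I * (κ : ℂ)) * v r))
      * ((Real.sinh r ^ (n + 1) : ℝ) : ℂ) with hC
  set D : ℝ → ℝ := fun r => deriv (deriv γ) r * ‖v r‖ ^ 2 * Real.sinh r ^ (n + 1) with hD
  have cstar : Continuous (starRingEnd ℂ) := Complex.continuous_conj
  have cA : ContinuousOn A (Ioi (0 : ℝ)) := by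
    simp only [hA, DradC]
    fun_prop
  have cB : ContinuousOn B (Ioi (0 : ℝ)) := by
    simp only [hB]
    fun_prop
  have cC : ContinuousOn C (Ioi (0 : ℝ)) := by
    simp only [hC]
    fun_prop
  have cD : ContinuousOn D (Ioi (0 : ℝ)) := by
    simp only [hD]
    fun_prop
  have A0 : ∀ r, r ∉ tsupport v → A r = 0 := fun r hr => by simp [hA, v0 r hr]
  have B0 : ∀ r, r ∉ tsupport v → B r = 0 := fun r hr => by simp [hB, v0 r hr, v10 r hr]
  have C0 : ∀ r, r ∉ tsupport v → C r = 0 := fun r hr => by simp [hC, v0 r hr]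
  have D0 : ∀ r, r ∉ tsupport v → D r = 0 := fun r hr => by simp [hD, v0 r hr]
  have iA := (integrable_of_eq_zero_off_compact hc hs cA A0).integrableOn (s := Ioi (0 : ℝ))
  have iB := (integrable_of_eq_zero_off_compact hc hs cB B0).integrableOn (s := Ioi (0 : ℝ))
  have iC := (integrable_of_eq_zero_off_compact hc hs cC C0).integrableOn (s := Ioi (0 : ℝ))
  have iD := (integrable_of_eq_zero_off_compact hc hs cD D0).integrableOn (s := Ioi (0 : ℝ))
  have iAre : IntegrableOn (fun r => (A r).re) (Ioi (0 : ℝ)) := iA.re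
  have iCre : IntegrableOn (fun r => (C r).re) (Ioi (0 : ℝ)) := iC.re
  have eA : (∫ r in Ioi (0 : ℝ), A r).re = ∫ r in Ioi (0 : ℝ), (A r).re :=
    (integral_re iA).symm
  have eC : (∫ r in Ioi (0 : ℝ), C r).re = ∫ r in Ioi (0 : ℝ), (C r).re :=
    (integral_re iC).symm
  rw [eA, eC]
  have key : ∫ r in Ioi (0 : ℝ), (-(A r).re - B r - 2 * κ * (C r).re + 1 / 2 * D r) = 0 := by
    refine setIntegral_Ioi_eq_zero_of_hasDerivAt (F := fun r =>
      (-(γ r * ((deriv v r).re * (v r).re + (deriv v r).im * (v r).im))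
        + (1 / 2 * deriv γ r - γ r * (rho (n + 2) * cothR r)) * ((v r).re ^ 2 + (v r).im ^ 2))
      * Real.sinh r ^ (n + 1)) hc hs (fun r hr => ?_) (by fun_prop)
      (fun r hr => by simp [v0 r hr])
      (fun r hr => by simp [A0 r hr, B0 r hr, C0 r hr, D0 r hr])
    have hsr : Real.sinh r ≠ 0 := (Real.sinh_pos_iff.2 hr).ne'
    have dre : ∀ {f : ℝ → ℂ}, ContDiff ℝ (⊤ : ℕ∞) f →
        HasDerivAt (fun x => (f x).re) (deriv f r).re r := fun hf =>
      Complex.reCLM.hasFDerivAt.comp_hasDerivAt r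
        (hf.differentiable (by simp) r).hasDerivAt
    have dim : ∀ {f : ℝ → ℂ}, ContDiff ℝ (⊤ : ℕ∞) f →
        HasDerivAt (fun x => (f x).im) (deriv f r).im r := fun hf =>
      Complex.imCLM.hasFDerivAt.comp_hasDerivAt r
        (hf.differentiable (by simp) r).hasDerivAt
    have dγ : HasDerivAt γ (deriv γ r) r :=
      ((hγ.differentiableOn (by simp)).differentiableAt (Ioi_mem_nhds hr)).hasDerivAt
    have dγ1 : HasDerivAt (deriv γ) (deriv (deriv γ) r) r :=
      ((hγ1.differentiableOn (by simp)).differentiableAt (Ioi_mem_nhds hr)).hasDerivAt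
    have main := ((dγ.mul (((dre hv1).mul (dre hv)).add ((dim hv1).mul (dim hv)))).neg.add
      (((dγ1.const_mul (1 / 2)).sub (dγ.mul ((hasDerivAt_cothR hr).const_mul (rho (n + 2))))).mul
        (((dre hv).pow 2).add ((dim hv).pow 2)))).mul ((Real.hasDerivAt_sinh r).pow (n + 1))
    refine main.congr_deriv ?_
    have hcs : Real.cosh r = cothR r * Real.sinh r := by
      rw [cothR, div_mul_cancel₀ _ hsr]
    have hcsq : cothR r ^ 2 = 1 + (Real.sinh r ^ 2)⁻¹ := by
      rw [cothR]
      field_simp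
      linear_combination Real.cosh_sq r
    have hnρ : (n : ℝ) = 2 * rho (n + 2) - 1 := by
      simp only [rho]
      push_cast
      ring
    simp only [hA, hB, hC, hD, DradC, Complex.sq_norm, Complex.normSq_apply, hcs, Nat.cast_add,
      Nat.cast_one, Nat.cast_ofNat, hnρ, Pi.mul_apply, Pi.add_apply, Pi.sub_apply, Pi.neg_apply,
      Pi.pow_apply, Complex.mul_re, Complex.mul_im,
      Complex.add_re, Complex.add_im, Complex.sub_re, Complex.sub_im, Complex.ofReal_re,
      Complex.ofReal_im, Complex.I_re, Complex.I_im, Complex.conj_re, Complex.conj_im,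
      Nat.add_sub_cancel]
    generalize rho (n + 2) = ρ at *
    generalize cothR r = c at *
    generalize (Real.sinh r ^ 2)⁻¹ = t at *
    linear_combination (-(ρ ^ 2 * γ r * ((v r).re ^ 2 + (v r).im ^ 2) * Real.sinh r ^ (n + 1))) * hcsq
  have iAneg : IntegrableOn (fun r => -(A r).re) (Ioi (0 : ℝ)) := iAre.neg
  have iAB : IntegrableOn (fun r => -(A r).re - B r) (Ioi (0 : ℝ)) := iAneg.sub iB
  have iABC : IntegrableOn (fun r => -(A r).re - B r - 2 * κ * (C r).re) (Ioi (0 : ℝ)) :=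
    iAB.sub (iCre.const_mul _)
  rw [integral_add iABC (iD.const_mul _), integral_sub iAB (iCre.const_mul _),
    integral_sub iAneg iB, integral_neg, integral_const_mul, integral_const_mul] at key
  linear_combination key
end

section
/- Main multiplier identity (Lemma 2.8, identity (2.7), radial form): let β : (0,∞) → ℝ be smooth and let Q be the associated multiplier. For every test function u, Re ∫ i (Δ_rad u) · conj(Q u) dμ_d = 2 ∫ β′ |u′|² dμ_d − 2ρ² ∫ β′ |u|² dμ_d − (1/2) ∫ (Δ_rad β′) |u|² dμ_d − ρ ∫ ( Δ_rad(β coth(r)) − 2ρ β′ ) |u|² dμ_d. -/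
open MeasureTheory Set

/-- The radial part of the Laplace–Beltrami operator of hyperbolic space,
acting on real-valued functions: `Δ_rad f = f″ + (d−1) coth(r) f′`. -/
noncomputable def DradR (d : ℕ) (f : ℝ → ℝ) (r : ℝ) : ℝ :=
  deriv (deriv f) r + ((d : ℝ) - 1) * cothR r * deriv f r

/-- The multiplier associated with a smooth real-valued `β` on `(0,∞)`:
`Q v = (1/i)(2 β v′ + β′ v + (d−1) coth(r) β v)`. -/
noncomputable def Qmul (d : ℕ) (β : ℝ → ℝ) (v : ℝ → ℂ) (r : ℝ) : ℂ :=
  Complex.I⁻¹ * (2 * ((β r : ℝ) : ℂ) * deriv v r + ((deriv β r : ℝ) : ℂ) * v r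
    + ((((d : ℝ) - 1) * cothR r * β r : ℝ) : ℂ) * v r)

/-- A test function vanishes outside a compact interval contained in `(0, ∞)`. -/
theorem IsTestFun.exists_bounds {u : ℝ → ℂ} (hu : IsTestFun u) :
    ∃ a b : ℝ, 0 < a ∧ a < b ∧ tsupport u ⊆ Ioo a b := by
  obtain ⟨-, hc, hs⟩ := hu
  obtain ⟨b, hb⟩ := IsCompact.bddAbove hc
  rcases (tsupport u).eq_empty_or_nonempty with h | h
  · exact ⟨1, 2, one_pos, one_lt_two, by simp [h]⟩
  · obtain ⟨m, hm, hmin⟩ := IsCompact.exists_isLeast hc h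
    have hm0 : 0 < m := hs hm
    have hmb : m ≤ b := hb hm
    exact ⟨m / 2, b + 1, by linarith, by linarith, fun x hx =>
      ⟨by linarith [hmin hx], by linarith [hb hx]⟩⟩

/-- An integral over `(0, ∞)` of a function vanishing outside `(a, b)` is an interval integral. -/
theorem setIntegral_Ioi_eq_intervalIntegral {E : Type*} [NormedAddCommGroup E] [NormedSpace ℝ E]
    {f : ℝ → E} {a b : ℝ} (ha : 0 < a) (hab : a < b) (hf : ∀ x ∉ Ioo a b, f x = 0) :
    ∫ r in Ioi (0 : ℝ), f r = ∫ r in a..b, f r := by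
  rw [intervalIntegral.integral_of_le hab.le]
  refine (setIntegral_eq_of_subset_of_forall_sdiff_eq_zero measurableSet_Ioi
    (fun x hx => ha.trans hx.1) fun x hx => hf x fun h => hx.2 ⟨h.1, h.2.le⟩)

theorem contDiffOn_cothR : ContDiffOn ℝ (⊤ : ℕ∞) cothR (Ioi (0 : ℝ)) :=
  Real.contDiff_cosh.contDiffOn.div Real.contDiff_sinh.contDiffOn
    fun _ hx => (Real.sinh_pos_iff.2 hx).ne'

theorem ContDiffOn.deriv_Ioi {f : ℝ → ℝ} (hf : ContDiffOn ℝ (⊤ : ℕ∞) f (Ioi (0 : ℝ))) :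
    ContDiffOn ℝ (⊤ : ℕ∞) (deriv f) (Ioi (0 : ℝ)) :=
  hf.deriv_of_isOpen isOpen_Ioi (by simp)

theorem ContDiffOn.hasDerivAt_Ioi {f : ℝ → ℝ} (hf : ContDiffOn ℝ (⊤ : ℕ∞) f (Ioi (0 : ℝ)))
    {x : ℝ} (hx : 0 < x) : HasDerivAt f (deriv f x) x :=
  ((hf.differentiableOn (by simp)).differentiableAt (Ioi_mem_nhds hx)).hasDerivAt

theorem ContDiff.deriv_smooth {u : ℝ → ℂ} (hu : ContDiff ℝ (⊤ : ℕ∞) u) :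
    ContDiff ℝ (⊤ : ℕ∞) (deriv u) :=
  (contDiff_infty_iff_deriv.1 hu).2

theorem hasDerivAt_sinh_pow (d : ℕ) (hd : 2 ≤ d) {x : ℝ} (hx : 0 < x) :
    HasDerivAt (fun r => Real.sinh r ^ (d - 1))
      (((d : ℝ) - 1) * cothR x * Real.sinh x ^ (d - 1)) x := by
  have hs : Real.sinh x ≠ 0 := (Real.sinh_pos_iff.2 hx).ne'
  refine ((Real.hasDerivAt_sinh x).pow (d - 1)).congr_deriv ?_
  obtain ⟨k, rfl⟩ := Nat.exists_eq_add_of_le' hd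
  simp only [cothR, show k + 2 - 1 = k + 1 by omega, Nat.add_sub_cancel]
  push_cast
  field_simp
  ring

/-- The boundary term in the multiplier identity, for the weight `w` and the multiplier given by
`β` and the zeroth order coefficient `g`. -/
noncomputable def multiplierFlux (w β g : ℝ → ℝ) (u : ℝ → ℂ) (r : ℝ) : ℝ :=
  w r * (β r * ((deriv u r).re ^ 2 + (deriv u r).im ^ 2)
    + g r * ((deriv u r).re * (u r).re + (deriv u r).im * (u r).im)
    - 1 / 2 * deriv g r * ((u r).re ^ 2 + (u r).im ^ 2))

theorem hasDerivAt_multiplierFlux {w β g : ℝ → ℝ} {u : ℝ → ℂ} {x c β' g' g'' : ℝ}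
    (hu : ContDiff ℝ (⊤ : ℕ∞) u) (hw : HasDerivAt w (c * w x) x) (hβ : HasDerivAt β β' x)
    (hg : HasDerivAt g g' x) (hg' : HasDerivAt (deriv g) g'' x) :
    HasDerivAt (multiplierFlux w β g u)
      (((deriv (deriv u) x).re + c * (deriv u x).re)
          * (2 * β x * (deriv u x).re + g x * (u x).re) * w x
        + ((deriv (deriv u) x).im + c * (deriv u x).im)
          * (2 * β x * (deriv u x).im + g x * (u x).im) * w x
        + (β' - c * β x + g x) * ((deriv u x).re ^ 2 + (deriv u x).im ^ 2) * w x
        - 1 / 2 * (g'' + c * g') * ((u x).re ^ 2 + (u x).im ^ 2) * w x) x := by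
  have hu0 : HasDerivAt u (deriv u x) x := ((hu.differentiable (by simp)) x).hasDerivAt
  have hu1 : HasDerivAt (deriv u) (deriv (deriv u) x) x :=
    ((hu.deriv_smooth.differentiable (by simp)) x).hasDerivAt
  have re0 := Complex.reCLM.hasFDerivAt.comp_hasDerivAt x hu0
  have im0 := Complex.imCLM.hasFDerivAt.comp_hasDerivAt x hu0
  have re1 := Complex.reCLM.hasFDerivAt.comp_hasDerivAt x hu1
  have im1 := Complex.imCLM.hasFDerivAt.comp_hasDerivAt x hu1
  have key := hw.mul (((hβ.mul ((re1.pow 2).add (im1.pow 2))).add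
    (hg.mul ((re1.mul re0).add (im1.mul im0)))).sub
    ((hg'.const_mul (1 / 2)).mul ((re0.pow 2).add (im0.pow 2))))
  refine key.congr_deriv ?_
  simp [hg.deriv]
  ring

/-- **Main multiplier identity** (Lemma 2.8, identity (2.7), radial form). -/
theorem main_multiplier_identity (d : ℕ) (hd : 2 ≤ d)
    (β : ℝ → ℝ) (hβ : ContDiffOn ℝ (⊤ : ℕ∞) β (Ioi (0 : ℝ)))
    (u : ℝ → ℂ) (hu : IsTestFun u) :
    (∫ r in Ioi (0 : ℝ),
        Complex.I * DradC d u r * (starRingEnd ℂ) (Qmul d β u r)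
          * ((Real.sinh r ^ (d - 1) : ℝ) : ℂ)).re
      = 2 * (∫ r in Ioi (0 : ℝ), deriv β r * ‖deriv u r‖ ^ 2 * Real.sinh r ^ (d - 1))
        - 2 * rho d ^ 2 * (∫ r in Ioi (0 : ℝ),
            deriv β r * ‖u r‖ ^ 2 * Real.sinh r ^ (d - 1))
        - (1 / 2) * (∫ r in Ioi (0 : ℝ),
            DradR d (deriv β) r * ‖u r‖ ^ 2 * Real.sinh r ^ (d - 1))
        - rho d * (∫ r in Ioi (0 : ℝ),
            (DradR d (fun x => β x * cothR x) r - 2 * rho d * deriv β r) * ‖u r‖ ^ 2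
              * Real.sinh r ^ (d - 1)) := by
  obtain ⟨a, b, ha, hab, hs⟩ := hu.exists_bounds
  have hu0 := hu.1
  have z0 : ∀ x ∉ Ioo a b, u x = 0 := fun x hx => image_eq_zero_of_notMem_tsupport (mt (@hs x) hx)
  have z1 : ∀ x ∉ Ioo a b, deriv u x = 0 := fun x hx =>
    image_eq_zero_of_notMem_tsupport fun h => hx (hs (tsupport_deriv_subset h))
  have hpos : ∀ x ∈ uIcc a b, 0 < x := fun x hx => by
    rw [uIcc_of_le hab.le] at hx
    exact ha.trans_le hx.1
  have hcoth := contDiffOn_cothR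
  have hβ1 := hβ.deriv_Ioi
  have hβ2 := hβ1.deriv_Ioi
  have hβ3 := hβ2.deriv_Ioi
  have hB : ContDiffOn ℝ (⊤ : ℕ∞) (fun x => β x * cothR x) (Ioi 0) := hβ.mul hcoth
  have hB1 := hB.deriv_Ioi
  have hB2 := hB1.deriv_Ioi
  set B : ℝ → ℝ := fun x => β x * cothR x with hBdef
  set g : ℝ → ℝ := fun x => deriv β x + ((d : ℝ) - 1) * B x with hg
  have hg0 : ∀ x, 0 < x → HasDerivAt g (deriv (deriv β) x + ((d : ℝ) - 1) * deriv B x) x :=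
    fun x hx => (hβ1.hasDerivAt_Ioi hx).add ((hB.hasDerivAt_Ioi hx).const_mul _)
  have hg1 : ∀ x, 0 < x → HasDerivAt (deriv g)
      (deriv (deriv (deriv β)) x + ((d : ℝ) - 1) * deriv (deriv B) x) x := fun x hx =>
    ((hβ2.hasDerivAt_Ioi hx).add ((hB1.hasDerivAt_Ioi hx).const_mul _)).congr_of_eventuallyEq
      (Filter.eventuallyEq_of_mem (Ioi_mem_nhds hx) fun y hy => (hg0 y hy).deriv)
  have cu : Continuous u := hu0.continuous
  have cu1 : Continuous (deriv u) := hu0.deriv_smooth.continuous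
  have cu2 : Continuous (deriv (deriv u)) := hu0.deriv_smooth.deriv_smooth.continuous
  have hsub : uIcc a b ⊆ Ioi 0 := hpos
  have cβ := hβ.continuousOn.mono hsub
  have cβ1 := hβ1.continuousOn.mono hsub
  have cβ2 := hβ2.continuousOn.mono hsub
  have cβ3 := hβ3.continuousOn.mono hsub
  have cB1 := hB1.continuousOn.mono hsub
  have cB2 := hB2.continuousOn.mono hsub
  have cc := hcoth.continuousOn.mono hsub
  have cw : Continuous fun r => Real.sinh r ^ (d - 1) := Real.continuous_sinh.pow _
  rw [setIntegral_Ioi_eq_intervalIntegral ha hab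
      (fun x hx => by simp [Qmul, z0 x hx, z1 x hx]),
    setIntegral_Ioi_eq_intervalIntegral ha hab (fun x hx => by simp [z1 x hx]),
    setIntegral_Ioi_eq_intervalIntegral ha hab (fun x hx => by simp [z0 x hx]),
    setIntegral_Ioi_eq_intervalIntegral ha hab (fun x hx => by simp [z0 x hx]),
    setIntegral_Ioi_eq_intervalIntegral ha hab (fun x hx => by simp [z0 x hx])]
  have i0 : IntervalIntegrable (fun r => Complex.I * DradC d u r *
      (starRingEnd ℂ) (Qmul d β u r) * ((Real.sinh r ^ (d - 1) : ℝ) : ℂ)) volume a b := by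
    apply ContinuousOn.intervalIntegrable
    simp only [DradC, Qmul]
    fun_prop
  have i1 : IntervalIntegrable
      (fun r => deriv β r * ‖deriv u r‖ ^ 2 * Real.sinh r ^ (d - 1)) volume a b := by
    apply ContinuousOn.intervalIntegrable
    fun_prop
  have i2 : IntervalIntegrable
      (fun r => deriv β r * ‖u r‖ ^ 2 * Real.sinh r ^ (d - 1)) volume a b := by
    apply ContinuousOn.intervalIntegrable
    fun_prop
  have i3 : IntervalIntegrable
      (fun r => DradR d (deriv β) r * ‖u r‖ ^ 2 * Real.sinh r ^ (d - 1)) volume a b := by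
    apply ContinuousOn.intervalIntegrable
    simp only [DradR]
    fun_prop
  have i4 : IntervalIntegrable
      (fun r => (DradR d B r - 2 * rho d * deriv β r) * ‖u r‖ ^ 2 * Real.sinh r ^ (d - 1))
      volume a b := by
    apply ContinuousOn.intervalIntegrable
    simp only [DradR]
    fun_prop
  have ire : IntervalIntegrable (fun r => (Complex.I * DradC d u r *
      (starRingEnd ℂ) (Qmul d β u r) * ((Real.sinh r ^ (d - 1) : ℝ) : ℂ)).re) volume a b :=
    ⟨i0.1.re, i0.2.re⟩
  have hre := Complex.reCLM.intervalIntegral_comp_comm i0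
  simp only [Complex.reCLM_apply] at hre
  rw [← hre]
  have ftc := intervalIntegral.integral_eq_sub_of_hasDerivAt
    (f := multiplierFlux (fun r => Real.sinh r ^ (d - 1)) β g u)
    (f' := fun r => 2 * (deriv β r * ‖deriv u r‖ ^ 2 * Real.sinh r ^ (d - 1))
        - 2 * rho d ^ 2 * (deriv β r * ‖u r‖ ^ 2 * Real.sinh r ^ (d - 1))
        - (1 / 2) * (DradR d (deriv β) r * ‖u r‖ ^ 2 * Real.sinh r ^ (d - 1))
        - rho d * ((DradR d B r - 2 * rho d * deriv β r) * ‖u r‖ ^ 2 * Real.sinh r ^ (d - 1))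
        - (Complex.I * DradC d u r *
      (starRingEnd ℂ) (Qmul d β u r) * ((Real.sinh r ^ (d - 1) : ℝ) : ℂ)).re) (a := a) (b := b)
    (fun x hx => (hasDerivAt_multiplierFlux hu0 (hasDerivAt_sinh_pow d hd (hpos x hx))
      (hβ.hasDerivAt_Ioi (hpos x hx)) (hg0 x (hpos x hx)) (hg1 x (hpos x hx))).congr_deriv ?_)
    (((((i1.const_mul _).sub (i2.const_mul _)).sub (i3.const_mul _)).sub (i4.const_mul _)).sub ire)
  · rw [intervalIntegral.integral_sub ((((i1.const_mul _).sub (i2.const_mul _)).sub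
        (i3.const_mul _)).sub (i4.const_mul _)) ire,
      intervalIntegral.integral_sub (((i1.const_mul _).sub (i2.const_mul _)).sub
        (i3.const_mul _)) (i4.const_mul _),
      intervalIntegral.integral_sub ((i1.const_mul _).sub (i2.const_mul _)) (i3.const_mul _),
      intervalIntegral.integral_sub (i1.const_mul _) (i2.const_mul _)] at ftc
    simp only [intervalIntegral.integral_const_mul] at ftc
    have hFa : multiplierFlux (fun r => Real.sinh r ^ (d - 1)) β g u a = 0 := by
      simp [multiplierFlux, z0 a (by simp), z1 a (by simp)]
    have hFb : multiplierFlux (fun r => Real.sinh r ^ (d - 1)) β g u b = 0 := by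
      simp [multiplierFlux, z0 b (by simp), z1 b (by simp)]
    rw [hFa, hFb] at ftc
    linarith
  · simp only [Complex.sq_norm, Complex.normSq_apply, DradC, DradR, Qmul, rho, hg, hBdef,
      Complex.inv_I, map_mul, map_add, map_neg, Complex.conj_I, Complex.conj_ofReal, map_ofNat,
      Complex.mul_re, Complex.mul_im, Complex.add_re, Complex.add_im, Complex.neg_re,
      Complex.neg_im, Complex.I_re, Complex.I_im, Complex.conj_re, Complex.conj_im,
      Complex.ofReal_re, Complex.ofReal_im, Complex.re_ofNat, Complex.im_ofNat]
    ring
end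

section
/- Third-derivative bound for the high-frequency multiplier weight (Lemma 6.2, inequality (6.6)): let C ≥ 1 and let α : [0,∞) → (0,∞) be smooth with |α′(y)| ≤ C α(y)/⟨y⟩ and |α″(y)| ≤ C α(y)/⟨y⟩² for all y ≥ 0. Then there is a constant C′ depending only on C such that for all s, δ, r > 0, |∂_r³ β_s(r)| ≤ C′ δ² s^{−1} ∂_r β_s(r), where β_s(r) = s^{1/2} ∫₀^{δ s^{−1/2} r} α(y)/⟨y⟩ dy. -/
open MeasureTheory Set

/-- The Japanese bracket `⟨y⟩ = (1+y²)^{1/2}`. -/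
noncomputable def jap (y : ℝ) : ℝ := Real.sqrt (1 + y ^ 2)

/-- The high-frequency multiplier weight
`β_s(r) = s^{1/2} ∫₀^{δ s^{−1/2} r} α(y)/⟨y⟩ dy`. -/
noncomputable def betaHigh (α : ℝ → ℝ) (δ s r : ℝ) : ℝ :=
  Real.sqrt s * ∫ y in (0 : ℝ)..(δ * r / Real.sqrt s), α y / jap y

theorem jap_pos (y : ℝ) : 0 < jap y := Real.sqrt_pos.2 (by positivity)

theorem jap_sq (y : ℝ) : jap y ^ 2 = 1 + y ^ 2 := Real.sq_sqrt (by positivity)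

theorem one_le_jap (y : ℝ) : 1 ≤ jap y :=
  Real.one_le_sqrt.2 (by nlinarith [sq_nonneg y])

theorem abs_le_jap (y : ℝ) : |y| ≤ jap y :=
  Real.abs_le_sqrt (by linarith)

theorem continuous_jap : Continuous jap := by
  unfold jap
  fun_prop

theorem hasDerivAt_jap (y : ℝ) : HasDerivAt jap (y / jap y) y := by
  have h : HasDerivAt (fun x : ℝ => 1 + x ^ 2) (2 * y) y := by
    simpa using (hasDerivAt_pow 2 y).const_add 1
  refine (h.sqrt (by positivity)).congr_deriv ?_
  have := (jap_pos y).ne'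
  unfold jap at *
  field_simp

theorem HasDerivAt.div_jap {α : ℝ → ℝ} {a y : ℝ} (h : HasDerivAt α a y) :
    HasDerivAt (fun x => α x / jap x) (a / jap y - α y * y / jap y ^ 3) y := by
  refine (h.div (hasDerivAt_jap y) (jap_pos y).ne').congr_deriv ?_
  have := (jap_pos y).ne'
  field_simp

theorem HasDerivAt.deriv_div_jap {α α' : ℝ → ℝ} {b y : ℝ} (h : HasDerivAt α (α' y) y)
    (h' : HasDerivAt α' b y) :
    HasDerivAt (fun x => α' x / jap x - α x * x / jap x ^ 3)
      (b / jap y - 2 * α' y * y / jap y ^ 3 + α y * (2 * y ^ 2 - 1) / jap y ^ 5) y := by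
  have hJ := (jap_pos y).ne'
  refine (h'.div_jap.sub ((h.mul (hasDerivAt_id y)).div ((hasDerivAt_jap y).pow 3)
    (pow_ne_zero 3 hJ))).congr_deriv ?_
  have hy : y ^ 2 = jap y ^ 2 - 1 := by rw [jap_sq]; ring
  simp only [id, Pi.mul_apply, Pi.pow_apply]
  field_simp
  push_cast
  ring_nf
  simp only [hy]
  ring

/-- The second derivative of `α / ⟨·⟩` is dominated by `α / ⟨·⟩` when `a`, `a₁`, `a₂` are the values
of `α` and its first two derivatives at `y`. -/
theorem abs_second_deriv_div_jap_le {C a a₁ a₂ y : ℝ} (hC : 0 ≤ C) (ha : 0 ≤ a)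
    (h₁ : |a₁| ≤ C * a / jap y) (h₂ : |a₂| ≤ C * a / jap y ^ 2) :
    |a₂ / jap y - 2 * a₁ * y / jap y ^ 3 + a * (2 * y ^ 2 - 1) / jap y ^ 5|
      ≤ (3 * C + 2) * (a / jap y) := by
  have hJ := jap_pos y
  have hJ1 := one_le_jap y
  have b₂ : |a₂ / jap y| ≤ C * a / jap y ^ 3 := by
    rw [abs_div, abs_of_pos hJ]
    calc |a₂| / jap y ≤ (C * a / jap y ^ 2) / jap y := by gcongr
      _ = _ := by field_simp
  have b₁ : |2 * a₁ * y / jap y ^ 3| ≤ 2 * C * a / jap y ^ 3 := by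
    rw [abs_div, abs_mul, abs_mul, abs_two, abs_of_pos (pow_pos hJ 3)]
    calc 2 * |a₁| * |y| / jap y ^ 3 ≤ 2 * (C * a / jap y) * jap y / jap y ^ 3 := by
          gcongr
          exact abs_le_jap y
      _ = _ := by field_simp
  have b₀ : |a * (2 * y ^ 2 - 1) / jap y ^ 5| ≤ 2 * a / jap y ^ 3 := by
    have hy : |2 * y ^ 2 - 1| ≤ 2 * jap y ^ 2 := by
      rw [jap_sq, abs_le]
      constructor <;> nlinarith [sq_nonneg y]
    rw [abs_div, abs_mul, abs_of_nonneg ha, abs_of_pos (pow_pos hJ 5)]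
    calc a * |2 * y ^ 2 - 1| / jap y ^ 5 ≤ a * (2 * jap y ^ 2) / jap y ^ 5 := by gcongr
      _ = _ := by field_simp
  calc _ ≤ |a₂ / jap y| + |2 * a₁ * y / jap y ^ 3| + |a * (2 * y ^ 2 - 1) / jap y ^ 5| :=
        (abs_add_le _ _).trans (by gcongr; exact abs_sub _ _)
    _ ≤ C * a / jap y ^ 3 + 2 * C * a / jap y ^ 3 + 2 * a / jap y ^ 3 := by gcongr
    _ = (3 * C + 2) * (a / jap y ^ 3) := by ring
    _ ≤ (3 * C + 2) * (a / jap y) := by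
        gcongr
        exact le_self_pow₀ hJ1 (by norm_num)

theorem hasDerivAt_betaHigh {α : ℝ → ℝ} (hα : ContinuousOn α (Ici 0)) {δ s r : ℝ}
    (hs : 0 < s) (hδ : 0 < δ) (hr : 0 < r) :
    HasDerivAt (betaHigh α δ s)
      (δ * (α (δ / √s * r) / jap (δ / √s * r))) r := by
  have hq : 0 < √s := Real.sqrt_pos.2 hs
  have hg : ContinuousOn (fun y => α y / jap y) (Ici 0) :=
    hα.div continuous_jap.continuousOn fun y _ => (jap_pos y).ne'
  have hx : 0 < δ * r / √s := by positivity
  have hint : IntervalIntegrable (fun y => α y / jap y) volume 0 (δ * r / √s) :=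
    (hg.mono (by rw [uIcc_of_le hx.le]; exact Icc_subset_Ici_self)).intervalIntegrable
  have hF := intervalIntegral.integral_hasDerivAt_right hint
    ((hg.mono Ioi_subset_Ici_self).stronglyMeasurableAtFilter isOpen_Ioi _ hx)
    (hg.continuousAt (Ici_mem_nhds hx))
  have hlin : HasDerivAt (fun r : ℝ => δ * r / √s) (δ / √s) r := by
    simpa using ((hasDerivAt_id r).const_mul δ).div_const √s
  refine ((hF.comp r hlin).const_mul √s).congr_deriv ?_
  rw [div_mul_eq_mul_div]
  field_simp

theorem HasDerivAt.const_mul_comp_const_mul {f : ℝ → ℝ} {f' k r : ℝ} (c : ℝ)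
    (h : HasDerivAt f f' (k * r)) :
    HasDerivAt (fun x => c * f (k * x)) (c * k * f') r := by
  refine ((h.comp r ((hasDerivAt_id r).const_mul k)).const_mul c).congr_deriv ?_
  ring

/-- **Third-derivative bound for the high-frequency multiplier weight** (Lemma 6.2,
inequality (6.6)): let `C ≥ 1` and let `α : [0,∞) → (0,∞)` be smooth with
`|α′(y)| ≤ C α(y)/⟨y⟩` and `|α″(y)| ≤ C α(y)/⟨y⟩²` for all `y ≥ 0`. Then there is
a constant `C′` depending only on `C` such that for all `s, δ, r > 0`,
`|∂_r³ β_s(r)| ≤ C′ δ² s⁻¹ ∂_r β_s(r)`. -/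
theorem high_freq_weight_third_derivative_bound (C : ℝ) (hC : 1 ≤ C) :
    ∃ C' : ℝ, ∀ α : ℝ → ℝ,
      ContDiffOn ℝ (⊤ : ℕ∞) α (Ici (0 : ℝ)) →
      (∀ y ∈ Ici (0 : ℝ), 0 < α y) →
      (∀ y ∈ Ici (0 : ℝ), |derivWithin α (Ici 0) y| ≤ C * α y / jap y) →
      (∀ y ∈ Ici (0 : ℝ),
        |derivWithin (derivWithin α (Ici 0)) (Ici 0) y| ≤ C * α y / jap y ^ 2) →
      ∀ s δ r : ℝ, 0 < s → 0 < δ → 0 < r →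
        |deriv (deriv (deriv (betaHigh α δ s))) r|
          ≤ C' * δ ^ 2 * s⁻¹ * deriv (betaHigh α δ s) r := by
  refine ⟨3 * C + 2, fun α hα hpos h₁ h₂ s δ r hs hδ hr => ?_⟩
  set α₁ := derivWithin α (Ici 0)
  set α₂ := derivWithin α₁ (Ici 0)
  have hα₁ : ContDiffOn ℝ (⊤ : ℕ∞) α₁ (Ici 0) :=
    hα.derivWithin (uniqueDiffOn_Ici 0) (by simp)
  have d₀ : ∀ y, 0 < y → HasDerivAt α (α₁ y) y := fun y hy =>
    ((hα.differentiableOn (by simp)) y hy.le).hasDerivWithinAt.hasDerivAt (Ici_mem_nhds hy)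
  have d₁ : ∀ y, 0 < y → HasDerivAt α₁ (α₂ y) y := fun y hy =>
    ((hα₁.differentiableOn (by simp)) y hy.le).hasDerivWithinAt.hasDerivAt (Ici_mem_nhds hy)
  have hq : 0 < √s := Real.sqrt_pos.2 hs
  set k := δ / √s with hk_def
  have hk : 0 < k := by positivity
  have hk2 : k ^ 2 = δ ^ 2 * s⁻¹ := by
    rw [hk_def, div_pow, Real.sq_sqrt hs.le, div_eq_mul_inv]
  have e₁ : EqOn (deriv (betaHigh α δ s)) (fun x => δ * (α (k * x) / jap (k * x))) (Ioi 0) :=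
    fun x hx => (hasDerivAt_betaHigh hα.continuousOn hs hδ hx).deriv
  have e₂ : EqOn (deriv (deriv (betaHigh α δ s)))
      (fun x => δ * k * (α₁ (k * x) / jap (k * x) - α (k * x) * (k * x) / jap (k * x) ^ 3))
      (Ioi 0) := fun x hx =>
    (e₁.eventuallyEq_of_mem (Ioi_mem_nhds hx)).deriv_eq.trans
      ((d₀ _ (mul_pos hk hx)).div_jap.const_mul_comp_const_mul δ).deriv
  have e₃ := (e₂.eventuallyEq_of_mem (Ioi_mem_nhds hr)).deriv_eq.trans
    (((d₀ _ (mul_pos hk hr)).deriv_div_jap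
      (d₁ _ (mul_pos hk hr))).const_mul_comp_const_mul (δ * k)).deriv
  have hy : k * r ∈ Ici (0 : ℝ) := (mul_pos hk hr).le
  rw [e₃, e₁ hr, abs_mul, abs_of_pos (by positivity)]
  calc _ ≤ δ * k * k * ((3 * C + 2) * (α (k * r) / jap (k * r))) := by
        gcongr
        exact abs_second_deriv_div_jap_le (by linarith) (hpos _ hy).le (h₁ _ hy) (h₂ _ hy)
    _ = (3 * C + 2) * k ^ 2 * (δ * (α (k * r) / jap (k * r))) := by ring
    _ = _ := by rw [hk2]; ring
end
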